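/- Let m ∈ {1/2, 1, 2} (as a real number), let n ≥ 2 be a natural number, and set N = m(n+1). Define f(0) = 1 and, for natural i ≥ 1, f(i) = (N)_{i−1} · (N−m)_i · (N+2i−1) / ((m)_i · i!). Then f(i) > f(i−1) for every natural number i ≥ 1. -/

import Mathlib

/-- Rising factorial (Pochhammer symbol): `(x)_k = x(x+1)⋯(x+k−1)`, with `(x)_0 = 1`. -/
def risingFactorial (x : ℝ) : ℕ → ℝ
  | 0 => 1
  | k + 1 => risingFactorial x k * (x + k)

theorem risingFactorial_pos' (x : ℝ) (hx : 0 < x) (k : ℕ) : 0 < risingFactorial x k := by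
  induction k with
  | zero => simp [risingFactorial]
  | succ k ih => simp only [risingFactorial]; positivity

/-- For `m ∈ {1/2, 1, 2}`, `n ≥ 2`, `N = m(n+1)`, the ranks
`f(0) = 1`, `f(i) = (N)_{i−1}·(N−m)_i·(N+2i−1)/((m)_i·i!)` for `i ≥ 1`
are strictly increasing: `f(i) > f(i−1)` for every `i ≥ 1`. -/
theorem rank_strict_growth
    (m : ℝ) (hm : m ∈ ({1/2, 1, 2} : Set ℝ))
    (n : ℕ) (hn : 2 ≤ n)
    (N : ℝ) (hN : N = m * (n + 1))
    (f : ℕ → ℝ) (hf0 : f 0 = 1)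
    (hf : ∀ i : ℕ, 1 ≤ i →
      f i = risingFactorial N (i - 1) * risingFactorial (N - m) i * (N + 2 * i - 1) /
        (risingFactorial m i * (Nat.factorial i : ℝ))) :
    ∀ i : ℕ, 1 ≤ i → f i > f (i - 1) := by
  have hm2 : 1 / 2 ≤ m := by
    simp only [Set.mem_insert_iff, Set.mem_singleton_iff] at hm
    rcases hm with h | h | h <;> rw [h] <;> norm_num
  have hn' : (2 : ℝ) ≤ n := by exact_mod_cast hn
  have hN3 : 3 * m ≤ N := by rw [hN]; nlinarith
  intro i hi
  obtain ⟨j, rfl⟩ : ∃ j, i = j + 1 := ⟨i - 1, by omega⟩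
  have hmpos : 0 < m := by linarith
  rcases j with _ | k
  · simp only [zero_add, Nat.sub_self, hf0]
    rw [hf 1 le_rfl]
    simp [risingFactorial]
    rw [lt_div_iff₀ hmpos]
    nlinarith
  · have e : k + 1 + 1 - 1 = k + 1 := by omega
    rw [e, hf (k + 1 + 1) (by omega), hf (k + 1) (by omega), e, Nat.add_sub_cancel]
    have hA := risingFactorial_pos' N (by linarith) k
    have hB := risingFactorial_pos' (N - m) (by linarith) (k + 1)
    have hD := risingFactorial_pos' m hmpos (k + 1)
    have hF : (0 : ℝ) < (Nat.factorial (k + 1) : ℝ) := by positivity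
    rw [show risingFactorial N (k + 1) = risingFactorial N k * (N + k) from rfl,
      show risingFactorial (N - m) (k + 1 + 1)
        = risingFactorial (N - m) (k + 1) * (N - m + (k + 1 : ℕ)) from rfl,
      show risingFactorial m (k + 1 + 1)
        = risingFactorial m (k + 1) * (m + (k + 1 : ℕ)) from rfl,
      Nat.factorial_succ (k + 1)]
    generalize risingFactorial N k = A at *
    generalize risingFactorial (N - m) (k + 1) = B at *
    generalize risingFactorial m (k + 1) = D at *
    generalize (Nat.factorial (k + 1)) = F at *
    push_cast
    have hk : (0 : ℝ) ≤ k := Nat.cast_nonneg k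
    generalize (k : ℝ) = x at *
    have key1 : (m + (x + 1)) * (x + 1 + 1) ≤ (N + x) * (N - m + (x + 1)) := by
      have h1 : (3 * m + x) * (2 * m + (x + 1)) ≤ (N + x) * (N - m + (x + 1)) := by
        apply mul_le_mul <;> linarith
      nlinarith [mul_nonneg (by linarith : 0 ≤ 2 * m - 1) hk,
        mul_nonneg (by linarith : 0 ≤ 2 * m - 1) hmpos.le]
    have hP : 0 < (m + (x + 1)) * (x + 1 + 1) := by positivity
    have key2 : (m + (x + 1)) * (x + 1 + 1) * (N + 2 * (x + 1) - 1)
        < (N + x) * (N - m + (x + 1)) * (N + 2 * (x + 1 + 1) - 1) := by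
      apply mul_lt_mul' key1 <;> linarith
    have hc : 0 < A * B * D * F := by positivity
    rw [gt_iff_lt, div_lt_div_iff₀ (by positivity) (by positivity)]
    have := mul_lt_mul_of_pos_left key2 hc
    linarith
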